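/- arXiv:2601.13394 — 2 statements merged into one kernel-verified Lean document; each statement's English description precedes it below -/
import Mathlib

section
/- The map G(u,v) = (F(u,v), H(u,v)) is differentiable at the extinction equilibrium (0,0), and its total derivative there is the linear map (x,y) ↦ ((1−m·s)·x, (1−γ)·y); i.e. the Jacobian matrix at (0,0) is the diagonal matrix with entries 1−m·s and 1−γ. Moreover, if in addition 0 < s·m < 1, then both eigenvalues 1−m·s and 1−γ of this Jacobian have absolute value strictly less than 1. -/
/-- G is differentiable at the extinction equilibrium (0,0) with Jacobian
diag(1−m·s, 1−γ); if moreover 0 < s·m < 1, both eigenvalues have modulus < 1. -/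
theorem jacobian_extinction (s ku m δ1 δ2 γ : ℝ)
    (hs : 0 < s) (hku : 0 < ku) (hm0 : 0 < m) (hm1 : m < 1)
    (hδ1 : 0 < δ1) (hδ2 : 0 < δ2) (hγ0 : 0 < γ) (hγ1 : γ < 1)
    (G : ℝ × ℝ → ℝ × ℝ)
    (hG : ∀ p : ℝ × ℝ, G p =
      (p.1 * (s * (1 - p.1 / ku) * (p.1 / ku - m) + 1) * (1 - δ1 * p.2),
       (p.2 + p.1 * (s * (1 - p.1 / ku) * (p.1 / ku - m) + 1) * δ2 * p.2) * (1 - γ))) :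
    HasFDerivAt G
      (((1 - m * s) • ContinuousLinearMap.fst ℝ ℝ ℝ).prod
        ((1 - γ) • ContinuousLinearMap.snd ℝ ℝ ℝ)) (0, 0) ∧
    (0 < s * m → s * m < 1 → |1 - m * s| < 1 ∧ |1 - γ| < 1) := by
  refine ⟨?_, fun h0 h1 => ⟨?_, ?_⟩⟩
  · have hG' : G = fun p : ℝ × ℝ =>
      (p.1 * (s * (1 - p.1 * ku⁻¹) * (p.1 * ku⁻¹ - m) + 1) * (1 - δ1 * p.2),
       (p.2 + p.1 * (s * (1 - p.1 * ku⁻¹) * (p.1 * ku⁻¹ - m) + 1) * δ2 * p.2) * (1 - γ)) := by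
      funext p
      rw [hG p]
      simp only [div_eq_mul_inv]
    rw [hG']
    have h1 : HasFDerivAt (fun p : ℝ × ℝ => p.1) (ContinuousLinearMap.fst ℝ ℝ ℝ) (0, 0) :=
      hasFDerivAt_fst
    have h2 : HasFDerivAt (fun p : ℝ × ℝ => p.2) (ContinuousLinearMap.snd ℝ ℝ ℝ) (0, 0) :=
      hasFDerivAt_snd
    have hk := h1.mul_const ku⁻¹
    have hA := h1.mul ((((hk.const_sub 1).const_mul s).mul (hk.sub_const m)).add_const 1)
    have hF := hA.mul ((h2.const_mul δ1).const_sub 1)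
    have hH := (h2.add ((hA.mul_const δ2).mul h2)).mul_const (1 - γ)
    refine (hF.prodMk hH).congr_fderiv ?_
    ext <;> simp <;> ring
  · rw [abs_lt]
    constructor <;> nlinarith
  · rw [abs_lt]
    constructor <;> linarith
end

section
/- The map G(u,v) = (F(u,v), H(u,v)) is differentiable at the predator-free equilibrium (k_u,0), and its Jacobian matrix there equals the upper-triangular matrix with rows (1+m·s−s, −δ₁·k_u) and (0, 1−γ+δ₂·k_u−δ₂·γ·k_u); in particular its eigenvalues are 1−s(1−m) and (1−γ)(1+δ₂·k_u). Moreover, if in addition 0 < s(1−m) < 1 and δ₂·k_u·(1−γ) < γ, then both eigenvalues have absolute value strictly less than 1. -/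
/-- G is differentiable at the predator-free equilibrium (k_u,0); its Jacobian is
the upper-triangular matrix with rows (1+m·s−s, −δ₁·k_u) and
(0, 1−γ+δ₂·k_u−δ₂·γ·k_u), whose diagonal entries (the eigenvalues) equal
1−s(1−m) and (1−γ)(1+δ₂·k_u); under the stated extra conditions both
eigenvalues have modulus < 1. -/
theorem jacobian_predator_free (s ku m δ1 δ2 γ : ℝ)
    (hs : 0 < s) (hku : 0 < ku) (hm0 : 0 < m) (hm1 : m < 1)
    (hδ1 : 0 < δ1) (hδ2 : 0 < δ2) (hγ0 : 0 < γ) (hγ1 : γ < 1)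
    (G : ℝ × ℝ → ℝ × ℝ)
    (hG : ∀ p : ℝ × ℝ, G p =
      (p.1 * (s * (1 - p.1 / ku) * (p.1 / ku - m) + 1) * (1 - δ1 * p.2),
       (p.2 + p.1 * (s * (1 - p.1 / ku) * (p.1 / ku - m) + 1) * δ2 * p.2) * (1 - γ))) :
    HasFDerivAt G
      ((((1 + m * s - s) • ContinuousLinearMap.fst ℝ ℝ ℝ) +
        ((-(δ1 * ku)) • ContinuousLinearMap.snd ℝ ℝ ℝ)).prod
        ((1 - γ + δ2 * ku - δ2 * γ * ku) • ContinuousLinearMap.snd ℝ ℝ ℝ)) (ku, 0) ∧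
    (1 + m * s - s = 1 - s * (1 - m) ∧
      1 - γ + δ2 * ku - δ2 * γ * ku = (1 - γ) * (1 + δ2 * ku)) ∧
    (0 < s * (1 - m) → s * (1 - m) < 1 → δ2 * ku * (1 - γ) < γ →
      |1 - s * (1 - m)| < 1 ∧ |(1 - γ) * (1 + δ2 * ku)| < 1) := by
  refine ⟨?_, ⟨by ring, by ring⟩, ?_⟩
  · have hGe : G = fun p : ℝ × ℝ =>
      (p.1 * (s * (1 - p.1 * ku⁻¹) * (p.1 * ku⁻¹ - m) + 1) * (1 - δ1 * p.2),
       (p.2 + p.1 * (s * (1 - p.1 * ku⁻¹) * (p.1 * ku⁻¹ - m) + 1) * δ2 * p.2) * (1 - γ)) := by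
      funext p
      rw [hG p]
      simp only [div_eq_mul_inv]
    rw [hGe]
    have hne : ku ≠ 0 := hku.ne'
    have h1 : HasFDerivAt (fun p : ℝ × ℝ => p.1) (ContinuousLinearMap.fst ℝ ℝ ℝ) (ku, (0 : ℝ)) :=
      hasFDerivAt_fst
    have h2 : HasFDerivAt (fun p : ℝ × ℝ => p.2) (ContinuousLinearMap.snd ℝ ℝ ℝ) (ku, (0 : ℝ)) :=
      hasFDerivAt_snd
    have hd := h1.mul_const ku⁻¹
    have hA := h1.mul ((((hd.const_sub 1).const_mul s).mul (hd.sub_const m)).add_const 1)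
    have hF := hA.mul ((h2.const_mul δ1).const_sub 1)
    have hH := (h2.add ((hA.mul_const δ2).mul h2)).mul_const (1 - γ)
    refine (hF.prodMk hH).congr_fderiv ?_
    ext <;> simp [hne] <;> field_simp <;> ring
  · intro h1 h2 h3
    have h4 : 0 < (1 - γ) * (1 + δ2 * ku) :=
      mul_pos (by linarith) (by positivity)
    constructor <;> rw [abs_lt] <;> constructor <;> nlinarith
end
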